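/- For a stable rotor-router state S_T, any family of bijections M_v : in(v) → out(v) (v ∈ V) that is valid with respect to the (2m²)-step subcycle decomposition of S_T is also valid with respect to the i-step subcycle decomposition for every i ≥ 1 (i.e., it is valid with respect to the ∞-subcycle decomposition). -/

import Mathlib

open Finset

namespace RotorRouter

variable {V : Type} [Fintype V] [DecidableEq V] (G : SimpleGraph V) [DecidableRel G.Adj]

/-- The outgoing arcs (darts) of a vertex `v`. -/
def outArcs (v : V) : Finset G.Dart := Finset.univ.filter (fun d => d.fst = v)

/-- The incoming arcs (darts) of a vertex `v`. -/
def inArcs (v : V) : Finset G.Dart := Finset.univ.filter (fun d => d.snd = v)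

/-- A state of the rotor-router system: at each vertex, the current pointer
(represented as an index, in the fixed cyclic order, of an outgoing arc) and the
number of tokens currently located at the vertex. -/
structure State where
  ptr : V → ℕ
  tokens : V → ℕ
  ptr_lt : ∀ v : V, 0 < G.degree v → ptr v < G.degree v

variable (ord : ∀ v : V, Fin (G.degree v) ≃ {d : G.Dart // d.fst = v})

/-- The number of tokens sent out on the `j`-th outgoing arc when `k` tokens leave a
vertex of degree `deg` in round-robin fashion, starting from pointer position `p`. -/
def sentCount (deg p k j : ℕ) : ℕ :=
  ((Finset.range k).filter (fun i => (p + i) % deg = j)).card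

/-- The number of tokens sent along the arc `d` during one step from state `S`. -/
def arcLoad (S : State G) (d : G.Dart) : ℕ :=
  sentCount (G.degree d.fst) (S.ptr d.fst) (S.tokens d.fst)
    (((ord d.fst).symm ⟨d, rfl⟩ : Fin (G.degree d.fst)) : ℕ)

/-- One synchronous step of the rotor-router system: every vertex sends out all of its
tokens in round-robin fashion, advancing its pointer after each token. -/
def step (S : State G) : State G where
  ptr v := if 0 < G.degree v then (S.ptr v + S.tokens v) % G.degree v else S.ptr v
  tokens v := (∑ d ∈ inArcs G v, arcLoad G ord S d) +
    (if 0 < G.degree v then 0 else S.tokens v)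
  ptr_lt v h := by simp only [if_pos h]; exact Nat.mod_lt _ h

/-- `evol S0 t` is the state `S_t` reached after `t` steps from the initial state `S0`. -/
def evol (S0 : State G) (t : ℕ) : State G := (step G ord)^[t] S0

/-- `load S0 t d` is `L_t(d)`, the number of tokens sent along arc `d` during step `t`. -/
def load (S0 : State G) (t : ℕ) (d : G.Dart) : ℕ := arcLoad G ord (evol G ord S0 t) d

/-- `cum S0 t1 t2 d` is the cumulative load `C_{t1}^{t2}(d) = Σ_{t1 ≤ t < t2} L_t(d)`. -/
def cum (S0 : State G) (t1 t2 : ℕ) (d : G.Dart) : ℕ :=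
  ∑ t ∈ Finset.Ico t1 t2, load G ord S0 t d

/-- `cumV S0 t1 t2 v` is the cumulative vertex load `C_{t1}^{t2}(v)`. -/
def cumV (S0 : State G) (t1 t2 : ℕ) (v : V) : ℕ :=
  ∑ t ∈ Finset.Ico t1 t2, (evol G ord S0 t).tokens v

/-- `pot S0 i t` is the `i`-th potential `Φ_i(S_t) = Σ_{e} (C_t^{t+i}(e))²`. -/
def pot (S0 : State G) (i t : ℕ) : ℕ := ∑ d : G.Dart, (cum G ord S0 t (t + i) d) ^ 2

/-- A state `S_t` is stable if it repeats: `S_{t'} = S_t` for some `t' > t`. -/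
def IsStable (S0 : State G) (t : ℕ) : Prop :=
  ∃ t' > t, evol G ord S0 t' = evol G ord S0 t

/-- A family of bijections `in(v) → out(v)` (encoded as a global bijection `M` on darts
with `(M d).fst = d.snd`) is valid w.r.t. the `Δt`-step subcycle decomposition of `S_T`
if `L_t(e) = L_{t+1}(M e)` for all arcs `e` and all `T ≤ t < T + Δt`. -/
def ValidMapping (S0 : State G) (T Δt : ℕ) (M : G.Dart → G.Dart) : Prop :=
  Function.Bijective M ∧ (∀ d : G.Dart, (M d).fst = d.snd) ∧
    ∀ (d : G.Dart) (t : ℕ), T ≤ t → t < T + Δt →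
      load G ord S0 t d = load G ord S0 (t + 1) (M d)

/-- `S_T` admits a `Δt`-step subcycle decomposition. -/
def HasSubcycleDecomp (S0 : State G) (T Δt : ℕ) : Prop :=
  ∃ M : G.Dart → G.Dart, ValidMapping G ord S0 T Δt M



set_option linter.unusedSectionVars false

section SentCount

theorem sentCount_add (deg p a b j : ℕ) :
    sentCount deg p (a + b) j = sentCount deg p a j + sentCount deg ((p + a) % deg) b j := by
  unfold sentCount
  rw [← Nat.count_eq_card_filter_range, ← Nat.count_eq_card_filter_range,
    ← Nat.count_eq_card_filter_range, Nat.count_add]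
  simp only [Nat.mod_add_mod, add_assoc]

/-- Round-robin distribution is balanced. -/
theorem exists_sentCount_balanced {deg p : ℕ} (hp : p < deg) (k : ℕ) :
    ∃ q, ∀ j < deg, q ≤ sentCount deg p k j ∧ sentCount deg p k j ≤ q + 1 := by
  have hdeg : 0 < deg := by omega
  have key : ∀ j < deg, (if j < p then 1 else 0) + sentCount deg p k j =
      (p + k) / deg + if j < (p + k) % deg then 1 else 0 := by
    intro j hj
    have h := Nat.count_add (fun i => i ≡ j [MOD deg]) p k
    rw [Nat.count_modEq_card _ hdeg, Nat.count_modEq_card _ hdeg, Nat.count_eq_card_filter_range,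
      Nat.mod_eq_of_lt hj, Nat.mod_eq_of_lt hp, Nat.div_eq_of_lt hp, zero_add] at h
    rw [h]
    simp only [sentCount, Nat.ModEq, Nat.mod_eq_of_lt hj]
  by_cases hr : p ≤ (p + k) % deg
  · refine ⟨(p + k) / deg, fun j hj => ?_⟩
    have := key j hj
    split_ifs at this <;> omega
  · refine ⟨(p + k) / deg - 1, fun j hj => ?_⟩
    have hpos : 1 ≤ (p + k) / deg := by
      rw [Nat.one_le_div_iff hdeg]
      by_contra hlt
      exact hr (by rw [Nat.mod_eq_of_lt (not_le.1 hlt)]; omega)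
    have := key j hj
    split_ifs at this <;> omega

theorem sum_sentCount {deg : ℕ} (hdeg : 0 < deg) (p k : ℕ) :
    ∑ j : Fin deg, sentCount deg p k j = k := by
  rw [Fin.sum_univ_eq_sum_range (fun j => sentCount deg p k j)]
  have := Finset.card_eq_sum_card_fiberwise (s := range k) (t := range deg)
    (f := fun i => (p + i) % deg) (fun i _ => by simpa using Nat.mod_lt _ hdeg)
  simpa [sentCount] using this.symm

end SentCount

section Balance

theorem degree_pos_of_dart (d : G.Dart) : 0 < G.degree d.fst :=
  (G.degree_pos_iff_exists_adj _).2 ⟨d.snd, d.adj⟩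

theorem arcLoad_eq (S : State G) {v : V} (d : {d : G.Dart // d.fst = v}) :
    arcLoad G ord S d = sentCount (G.degree v) (S.ptr v) (S.tokens v) ((ord v).symm d) := by
  obtain ⟨d, rfl⟩ := d
  rfl

theorem sum_out_arcLoad (S : State G) {v : V} (hv : 0 < G.degree v) :
    ∑ d : G.Dart with d.fst = v, arcLoad G ord S d = S.tokens v := by
  rw [← Finset.sum_subtype_eq_sum_filter, Finset.subtype_univ]
  simp only [arcLoad_eq]
  rw [Equiv.sum_comp (ord v).symm
    (fun j => sentCount (G.degree v) (S.ptr v) (S.tokens v) (j : ℕ)), sum_sentCount hv]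

theorem evol_succ (S0 : State G) (t : ℕ) :
    evol G ord S0 (t + 1) = step G ord (evol G ord S0 t) :=
  Function.iterate_succ_apply' _ _ _

theorem evol_add (S0 : State G) (s t : ℕ) :
    evol G ord S0 (s + t) = evol G ord (evol G ord S0 t) s :=
  Function.iterate_add_apply _ _ _ _

theorem cum_succ (S0 : State G) {s t : ℕ} (h : s ≤ t) (d : G.Dart) :
    cum G ord S0 s (t + 1) d = cum G ord S0 s t d + load G ord S0 t d :=
  Finset.sum_Ico_succ_top h _

theorem ptr_evol_add (S0 : State G) (t i : ℕ) {v : V} (hv : 0 < G.degree v) :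
    (evol G ord S0 (t + i)).ptr v =
      ((evol G ord S0 t).ptr v + cumV G ord S0 t (t + i) v) % G.degree v := by
  induction i with
  | zero => simp [cumV, Nat.mod_eq_of_lt ((evol G ord S0 t).ptr_lt v hv)]
  | succ i ih =>
    rw [← add_assoc, evol_succ, cumV, Finset.sum_Ico_succ_top (by omega), ← cumV]
    simp only [step, if_pos hv, ih, Nat.mod_add_mod, add_assoc]

theorem cum_eq_sentCount (S0 : State G) (t i : ℕ) {v : V} (d : {d : G.Dart // d.fst = v}) :
    cum G ord S0 t (t + i) d = sentCount (G.degree v) ((evol G ord S0 t).ptr v)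
      (cumV G ord S0 t (t + i) v) ((ord v).symm d) := by
  have hv : 0 < G.degree v := by
    obtain ⟨d, rfl⟩ := d
    exact degree_pos_of_dart G d
  induction i with
  | zero => simp [cum, cumV, sentCount]
  | succ i ih =>
    rw [← add_assoc, cum_succ _ _ _ (by omega), cumV, Finset.sum_Ico_succ_top (by omega), ← cumV,
      sentCount_add, ← ptr_evol_add _ _ _ _ _ hv, ih, load, arcLoad_eq]

/-- Cumulative loads on the arcs leaving a vertex are balanced. -/
theorem exists_cum_out_balanced (S0 : State G) (t i : ℕ) (v : V) :
    ∃ q, ∀ d : G.Dart, d.fst = v →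
      q ≤ cum G ord S0 t (t + i) d ∧ cum G ord S0 t (t + i) d ≤ q + 1 := by
  rcases Nat.eq_zero_or_pos (G.degree v) with hv | hv
  · refine ⟨0, fun d hd => ?_⟩
    have := degree_pos_of_dart G d
    rw [hd] at this
    omega
  · obtain ⟨q, hq⟩ := exists_sentCount_balanced ((evol G ord S0 t).ptr_lt v hv)
      (cumV G ord S0 t (t + i) v)
    refine ⟨q, fun d hd => ?_⟩
    rw [cum_eq_sentCount G ord S0 t i ⟨d, hd⟩]
    exact hq _ (Fin.is_lt _)

end Balance

section Potential

variable {G} {M : G.Dart → G.Dart}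

theorem sum_in_comp (hbij : Function.Bijective M) (hfst : ∀ d, (M d).fst = d.snd)
    (f : G.Dart → ℕ) (v : V) :
    ∑ d : G.Dart with d.snd = v, f (M d) = ∑ d : G.Dart with d.fst = v, f d :=
  Finset.sum_bijective M hbij (fun d => by simp [hfst]) (fun _ _ => rfl)

theorem sum_in_load (hbij : Function.Bijective M) (hfst : ∀ d, (M d).fst = d.snd)
    (S0 : State G) (t : ℕ) (v : V) :
    ∑ d : G.Dart with d.snd = v, load G ord S0 (t + 1) (M d) =
      ∑ d : G.Dart with d.snd = v, load G ord S0 t d := by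
  rcases Nat.eq_zero_or_pos (G.degree v) with hv | hv
  · refine Finset.sum_eq_zero_iff_of_nonneg (by simp) |>.2 ?_ |>.trans
      (Finset.sum_eq_zero_iff_of_nonneg (by simp) |>.2 ?_).symm <;>
    · intro d hd
      have : 0 < G.degree d.snd := degree_pos_of_dart G d.symm
      rw [(mem_filter.1 hd).2] at this
      omega
  · rw [sum_in_comp hbij hfst (load G ord S0 (t + 1))]
    simp only [load]
    rw [sum_out_arcLoad G ord _ hv, evol_succ]
    simp [step, inArcs, hv.ne']

theorem sum_in_cum (hbij : Function.Bijective M) (hfst : ∀ d, (M d).fst = d.snd)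
    (S0 : State G) (t i : ℕ) (v : V) :
    ∑ d : G.Dart with d.snd = v, cum G ord S0 (t + 1) (t + 1 + i) (M d) =
      ∑ d : G.Dart with d.snd = v, cum G ord S0 t (t + i) d := by
  simp only [cum]
  rw [Finset.sum_comm, Finset.sum_comm (t := Finset.Ico t (t + i)),
    show t + 1 + i = t + i + 1 by omega, ← Finset.sum_Ico_add']
  exact Finset.sum_congr rfl fun s _ => sum_in_load ord hbij hfst S0 s v

/-- The drop of the potential in one step, expressed through the imbalance of the cumulative
loads on incoming arcs with respect to any balancing level `q` of the outgoing ones. -/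
theorem pot_eq (hbij : Function.Bijective M) (hfst : ∀ d, (M d).fst = d.snd)
    (S0 : State G) (t i : ℕ) (q : V → ℕ)
    (hq : ∀ d : G.Dart, q d.fst ≤ cum G ord S0 (t + 1) (t + 1 + i) d ∧
      cum G ord S0 (t + 1) (t + 1 + i) d ≤ q d.fst + 1) :
    (pot G ord S0 i t : ℤ) = pot G ord S0 i (t + 1) + ∑ d : G.Dart,
      ((cum G ord S0 t (t + i) d : ℤ) - q d.snd) * (cum G ord S0 t (t + i) d - q d.snd - 1) := by
  have hpot : pot G ord S0 i (t + 1) =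
      ∑ d : G.Dart, (cum G ord S0 (t + 1) (t + 1 + i) (M d)) ^ 2 :=
    (hbij.sum_comp fun d => (cum G ord S0 (t + 1) (t + 1 + i) d) ^ 2).symm
  have hlin : ∑ d : G.Dart, (2 * q d.snd + 1) * cum G ord S0 (t + 1) (t + 1 + i) (M d) =
      ∑ d : G.Dart, (2 * q d.snd + 1) * cum G ord S0 t (t + i) d := by
    rw [← Finset.sum_fiberwise univ (fun d : G.Dart => d.snd),
      ← Finset.sum_fiberwise univ (fun d : G.Dart => d.snd)
        (fun d => (2 * q d.snd + 1) * cum G ord S0 t (t + i) d)]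
    refine Finset.sum_congr rfl fun v _ => ?_
    have hv : ∀ f : G.Dart → ℕ, ∑ d : G.Dart with d.snd = v, (2 * q d.snd + 1) * f d =
        (2 * q v + 1) * ∑ d : G.Dart with d.snd = v, f d := fun f => by
      rw [Finset.mul_sum]
      exact Finset.sum_congr rfl fun d hd => by rw [(mem_filter.1 hd).2]
    rw [hv (fun d => cum G ord S0 (t + 1) (t + 1 + i) (M d)), hv, sum_in_cum ord hbij hfst]
  have hzero : ∀ d : G.Dart, ((cum G ord S0 (t + 1) (t + 1 + i) (M d) : ℤ) - q d.snd) *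
      (cum G ord S0 (t + 1) (t + 1 + i) (M d) - q d.snd - 1) = 0 := fun d => by
    have h := hq (M d)
    rw [hfst] at h
    have h' : cum G ord S0 (t + 1) (t + 1 + i) (M d) = q d.snd ∨
      cum G ord S0 (t + 1) (t + 1 + i) (M d) = q d.snd + 1 := by omega
    rcases h' with h' | h' <;> simp [h']
  rw [← sub_eq_zero]
  have hlin' := congrArg (Nat.cast (R := ℤ)) hlin.symm
  rw [hpot, pot]
  push_cast at hlin' ⊢
  rw [← sub_eq_zero, ← Finset.sum_sub_distrib] at hlin'
  rw [← Finset.sum_add_distrib, ← Finset.sum_sub_distrib, ← hlin', ← sub_eq_zero,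
    ← Finset.sum_sub_distrib]
  refine Finset.sum_eq_zero fun d _ => ?_
  linear_combination -hzero d

theorem mul_sub_one_nonneg (x : ℤ) : 0 ≤ x * (x - 1) := by
  rcases le_or_gt x 0 with h | h <;> nlinarith

theorem pot_antitone (hbij : Function.Bijective M) (hfst : ∀ d, (M d).fst = d.snd)
    (S0 : State G) (i : ℕ) : Antitone (pot G ord S0 i) := by
  refine antitone_nat_of_succ_le fun t => ?_
  choose q hq using exists_cum_out_balanced G ord S0 (t + 1) i
  have h := pot_eq ord hbij hfst S0 t i q fun d => hq _ d rfl
  have h0 : 0 ≤ ∑ d : G.Dart, ((cum G ord S0 t (t + i) d : ℤ) - q d.snd) *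
      (cum G ord S0 t (t + i) d - q d.snd - 1) :=
    Finset.sum_nonneg fun d _ => mul_sub_one_nonneg _
  omega

theorem cum_add_eq (S0 : State G) (t p i : ℕ) (d : G.Dart) :
    cum G ord S0 (t + p) (t + p + i) d = cum G ord (evol G ord S0 p) t (t + i) d := by
  rw [cum, cum, show t + p + i = t + i + p by omega, ← Finset.sum_Ico_add']
  exact Finset.sum_congr rfl fun s _ => by rw [load, load, evol_add]

theorem pot_add (S0 : State G) (i t p : ℕ) :
    pot G ord S0 i (t + p) = pot G ord (evol G ord S0 p) i t :=
  Finset.sum_congr rfl fun d _ => by rw [cum_add_eq]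

theorem pot_succ_eq_of_isStable (hbij : Function.Bijective M) (hfst : ∀ d, (M d).fst = d.snd)
    {S0 : State G} {T : ℕ} (hstable : IsStable G ord S0 T) (i : ℕ) {t : ℕ} (ht : T ≤ t) :
    pot G ord S0 i (t + 1) = pot G ord S0 i t := by
  obtain ⟨T', hT', h⟩ := hstable
  have hanti := pot_antitone ord hbij hfst S0 i
  refine le_antisymm (hanti (by omega)) ?_
  obtain ⟨s, rfl⟩ := Nat.exists_eq_add_of_le' ht
  calc pot G ord S0 i (s + T) = pot G ord S0 i (s + T') := by rw [pot_add, pot_add, h]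
    _ ≤ pot G ord S0 i (s + T + 1) := hanti (by omega)

/-- In a stable state, cumulative loads on the arcs entering a vertex are balanced. -/
theorem cum_in_le_of_isStable (hbij : Function.Bijective M) (hfst : ∀ d, (M d).fst = d.snd)
    {S0 : State G} {T : ℕ} (hstable : IsStable G ord S0 T) (i : ℕ) {t : ℕ} (ht : T ≤ t)
    {e f : G.Dart} (hef : e.snd = f.snd) :
    cum G ord S0 t (t + i) e ≤ cum G ord S0 t (t + i) f + 1 := by
  choose q hq using exists_cum_out_balanced G ord S0 (t + 1) i
  have h := pot_eq ord hbij hfst S0 t i q fun d => hq _ d rfl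
  rw [pot_succ_eq_of_isStable ord hbij hfst hstable i ht, left_eq_add,
    Finset.sum_eq_zero_iff_of_nonneg fun d _ => mul_sub_one_nonneg _] at h
  have he := mul_eq_zero.1 (h e (mem_univ _))
  have hf := mul_eq_zero.1 (h f (mem_univ _))
  rw [hef] at he
  omega

theorem cum_out_le (S0 : State G) (i t : ℕ) {e f : G.Dart} (hef : e.fst = f.fst) :
    cum G ord S0 t (t + i) e ≤ cum G ord S0 t (t + i) f + 1 := by
  obtain ⟨q, hq⟩ := exists_cum_out_balanced G ord S0 t i f.fst
  have he := hq e hef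
  have hf := hq f rfl
  omega

end Potential

section Extension

variable {G} {M : G.Dart → G.Dart} {S0 : State G} {T : ℕ}

theorem ValidMapping.load_iterate {Δ : ℕ} (hM : ValidMapping G ord S0 T Δ M) (d : G.Dart) {t : ℕ}
    (ht : T ≤ t) (n : ℕ) (hn : t + n ≤ T + Δ) :
    load G ord S0 (t + n) (M^[n] d) = load G ord S0 t d := by
  induction n with
  | zero => rfl
  | succ n ih =>
    rw [Function.iterate_succ_apply', ← add_assoc, ← hM.2.2 _ _ (by omega) (by omega),
      ih (by omega)]

theorem ValidMapping.cum_comp {Δ : ℕ} (hM : ValidMapping G ord S0 T Δ M) (d : G.Dart) {s t : ℕ}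
    (hs : T ≤ s) (ht : t ≤ T + Δ) :
    cum G ord S0 (s + 1) (t + 1) (M d) = cum G ord S0 s t d := by
  rw [cum, ← Finset.sum_Ico_add']
  refine Finset.sum_congr rfl fun r hr => ?_
  rw [mem_Ico] at hr
  exact (hM.2.2 d r (by omega) (by omega)).symm

/-- If the mapping fails right after its window of validity, then two arcs into a common vertex
carry equal loads throughout the window, and different loads right after it. -/
theorem ValidMapping.exists_of_load_ne (hstable : IsStable G ord S0 T) {Δ : ℕ}
    (hM : ValidMapping G ord S0 T Δ M) {d : G.Dart}
    (hd : load G ord S0 (T + Δ) d ≠ load G ord S0 (T + Δ + 1) (M d)) :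
    ∃ e f : G.Dart, e.snd = f.snd ∧
      load G ord S0 (T + Δ) e ≠ load G ord S0 (T + Δ) f ∧
      ∀ s, T ≤ s → s < T + Δ → load G ord S0 s e = load G ord S0 s f := by
  obtain ⟨hbij, hfst, -⟩ := id hM
  set t := T + Δ with ht
  have hsum := congrArg (Nat.cast (R := ℤ)) (sum_in_load ord hbij hfst S0 t d.snd)
  push_cast at hsum
  have hd' : d ∈ (univ.filter fun d' : G.Dart => d'.snd = d.snd) := by simp
  obtain ⟨e, he, hel⟩ := Finset.exists_pos_of_sum_zero_of_exists_nonzero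
    (s := univ.filter fun d' : G.Dart => d'.snd = d.snd)
    (fun d' => (load G ord S0 t d' : ℤ) - load G ord S0 (t + 1) (M d'))
    (by rw [Finset.sum_sub_distrib, hsum, sub_self]) ⟨d, hd', by omega⟩
  obtain ⟨f, hf, hfl⟩ := Finset.exists_pos_of_sum_zero_of_exists_nonzero
    (s := univ.filter fun d' : G.Dart => d'.snd = d.snd)
    (fun d' => (load G ord S0 (t + 1) (M d') : ℤ) - load G ord S0 t d')
    (by rw [Finset.sum_sub_distrib, hsum, sub_self]) ⟨d, hd', by omega⟩
  have hef : e.snd = f.snd := (mem_filter.1 he).2.trans (mem_filter.1 hf).2.symm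
  have hin : ∀ s, T ≤ s → s ≤ t → cum G ord S0 s (t + 1) e ≤ cum G ord S0 s (t + 1) f + 1 :=
    fun s hs hst => by
      have := cum_in_le_of_isStable ord hbij hfst hstable (t + 1 - s) hs hef
      rwa [Nat.add_sub_cancel' (by omega)] at this
  have hout : ∀ s, T ≤ s → s ≤ t →
      cum G ord S0 (s + 1) (t + 1 + 1) (M f) ≤ cum G ord S0 (s + 1) (t + 1 + 1) (M e) + 1 :=
    fun s hs hst => by
      have := cum_out_le ord S0 (t + 1 - s) (s + 1) (e := M f) (f := M e) (by simp [hfst, hef])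
      rwa [show s + 1 + (t + 1 - s) = t + 1 + 1 by omega] at this
  have hin_t := hin t (by omega) le_rfl
  have hout_t := hout t (by omega) le_rfl
  simp only [cum, Nat.Ico_succ_singleton, Finset.sum_singleton] at hin_t hout_t
  have hcum : ∀ s, T ≤ s → s ≤ t → cum G ord S0 s t e = cum G ord S0 s t f := fun s hs hst => by
    have h1 := hin s hs hst
    have h2 := hout s hs hst
    rw [cum_succ _ _ _ hst, cum_succ _ _ _ hst] at h1
    rw [cum_succ _ _ _ (Nat.add_le_add_right hst 1) (M f),
      cum_succ _ _ _ (Nat.add_le_add_right hst 1) (M e), hM.cum_comp ord _ hs ht.le,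
      hM.cum_comp ord _ hs ht.le] at h2
    omega
  refine ⟨e, f, hef, by omega, fun s hs hst => ?_⟩
  have h1 := hcum s hs hst.le
  have h2 := hcum (s + 1) (by omega) (by omega)
  simp only [cum] at h1 h2
  rw [Finset.sum_eq_sum_Ico_succ_bot hst, Finset.sum_eq_sum_Ico_succ_bot hst, h2] at h1
  omega

theorem two_le_card_edgeFinset {e f : G.Dart} (hsnd : e.snd = f.snd) (hne : e ≠ f) :
    2 ≤ #G.edgeFinset := by
  have hedge : e.edge ≠ f.edge := fun h => by
    rcases (SimpleGraph.dart_edge_eq_iff e f).1 h with h | rfl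
    · exact hne h
    · exact f.symm.adj.ne hsnd.symm
  exact Finset.one_lt_card.2 ⟨_, by simp, _, by simp, hedge⟩

theorem ValidMapping.succ (hstable : IsStable G ord S0 T) {Δ : ℕ}
    (hΔ : 2 * #G.edgeFinset ^ 2 ≤ Δ) (hM : ValidMapping G ord S0 T Δ M) :
    ValidMapping G ord S0 T (Δ + 1) M := by
  refine ⟨hM.1, hM.2.1, fun d t ht htΔ => ?_⟩
  rcases (show t ≤ T + Δ by omega).lt_or_eq with hlt | rfl
  · exact hM.2.2 d t ht hlt
  by_contra hd
  obtain ⟨e, f, hef, hne, heq⟩ := hM.exists_of_load_ne ord hstable hd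
  have hcard := two_le_card_edgeFinset hef fun h => hne (h ▸ rfl)
  have hper : ∀ d : G.Dart, ∃ k, 0 < k ∧ k ≤ 2 * #G.edgeFinset ∧ M^[k] d = d := fun d =>
    ⟨Function.minimalPeriod M d,
      Function.minimalPeriod_pos_of_mem_periodicPts (hM.1.injective.mem_periodicPts d),
      G.dart_card_eq_twice_card_edges ▸ Function.minimalPeriod_le_card,
      Function.iterate_minimalPeriod⟩
  obtain ⟨k, hk, hkm, hke⟩ := hper e
  obtain ⟨l, hl, hlm, hlf⟩ := hper f
  have hkl : k + l ≤ Δ := by nlinarith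
  have he : ∀ s, T ≤ s → s + k ≤ T + Δ → load G ord S0 (s + k) e = load G ord S0 s e :=
    fun s hs hs' => by simpa only [hke] using hM.load_iterate ord e hs k hs'
  have hf : ∀ s, T ≤ s → s + l ≤ T + Δ → load G ord S0 (s + l) f = load G ord S0 s f :=
    fun s hs hs' => by simpa only [hlf] using hM.load_iterate ord f hs l hs'
  obtain ⟨r, hr⟩ := Nat.exists_eq_add_of_le (show T + (k + l) ≤ T + Δ by omega)
  refine hne ?_
  calc load G ord S0 (T + Δ) e = load G ord S0 (T + r + l + k) e := by congr 1; omega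
    _ = load G ord S0 (T + r + l) f := by
      rw [he _ (by omega) (by omega), heq _ (by omega) (by omega)]
    _ = load G ord S0 (T + r + k) e := by
      rw [hf _ (by omega) (by omega), he _ (by omega) (by omega), heq _ (by omega) (by omega)]
    _ = load G ord S0 (T + r + k + l) f := by
      rw [heq _ (by omega) (by omega), hf _ (by omega) (by omega)]
    _ = load G ord S0 (T + Δ) f := by congr 1; omega

end Extension

/-- For a stable state `S_T`, any family of bijections `in(v) → out(v)`
valid w.r.t. the `(2m²)`-step subcycle decomposition of `S_T` is valid w.r.t. the
`i`-step subcycle decomposition for every `i ≥ 1`. -/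
theorem valid_mapping_forever (hconn : G.Connected) (S0 : State G) (T : ℕ)
    (hstable : IsStable G ord S0 T) (M : G.Dart → G.Dart)
    (hM : ValidMapping G ord S0 T (2 * G.edgeFinset.card ^ 2) M) :
    ∀ i : ℕ, 1 ≤ i → ValidMapping G ord S0 T i M := by
  intro i _
  have hall : ∀ n, ValidMapping G ord S0 T (2 * G.edgeFinset.card ^ 2 + n) M := fun n => by
    induction n with
    | zero => exact hM
    | succ n ih => exact ih.succ ord hstable (Nat.le_add_right _ _)
  exact ⟨hM.1, hM.2.1, fun d t ht hti => (hall i).2.2 d t ht (by omega)⟩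

end RotorRouter
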